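/- arXiv:1206.4301 — 2 statements merged into one kernel-verified Lean document; each statement's English description precedes it below -/
import Mathlib

section
/- For a vector x = (x₁, …, x₇) ∈ ℚ⁷, the equations Σᵢ xᵢ Mᵢⱼ = bⱼ (j = 1, …, 6) hold if and only if there exists d ∈ ℚ such that x = ((459 + 560d)/6, (−18 − 58d)/3, (−117 − 136d)/3, d, (18 + 14d)/3, (99 + 32d)/6, −9/2). -/
open Matrix

/-- The matrix of the pull-back map `φ* : A²(M̄₃) → A²(M̄₀,₈)^{S₈}` in the bases
`(λ², λδ₀, λδ₁, δ₀², δ₀δ₁, δ₁², κ₂)` and `(d₅₁₂, d₄₂₂, d₄₁₃, d₃₃₂, d₃₂₃, d₂₄₂)`. -/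
def M : Matrix (Fin 7) (Fin 6) ℚ :=
  !![1/42, 19/210, 1/35, 1/20, 1/35, 3/35;
     0, 11/15, 0, 1/5, 0, 4/5;
     1/12, 0, 1/10, 1/10, 1/10, 0;
     -8/3, 86/15, -2, -4/5, 0, 112/15;
     1, 0, 1, 1, 0, 0;
     -1/12, 0, -3/20, -1/40, 7/20, 0;
     13/84, 6/35, 33/140, 1/8, 33/140, 2/35]

/-- The coordinate vector of the class `[Ī₈^inv]`. -/
def b : Fin 6 → ℚ := ![5/2, 7/4, 3/4, 15/4, 3, 3/2]

/-- `x ∈ ℚ⁷` satisfies `xᵀ M = b` iff it lies in the one-parameter family of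
candidate coordinate vectors for the bielliptic class. -/
theorem solutions_eq_one_parameter_family (x : Fin 7 → ℚ) :
    (∀ j : Fin 6, ∑ i : Fin 7, x i * M i j = b j) ↔
    ∃ d : ℚ, x = ![(459 + 560 * d) / 6, (-18 - 58 * d) / 3, (-117 - 136 * d) / 3,
      d, (18 + 14 * d) / 3, (99 + 32 * d) / 6, -9/2] := by
  simp only [Fin.forall_fin_succ, Fin.sum_univ_succ, M, b]
  simp
  constructor
  · rintro ⟨h1, h2, h3, h4, h5, h6⟩
    refine ⟨x 3, ?_⟩
    ext i
    fin_cases i <;> simp <;> linarith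
  · rintro ⟨d, rfl⟩
    simp
    refine ⟨?_, ?_, ?_, ?_, ?_, ?_⟩ <;> ring
end

section
/- The ideal of the polynomial ring ℚ[x₀, x₁, x₂, x₃, x₄, x₅] generated by the two polynomials x₀x₁ − x₂x₃ and x₀x₁ − x₄x₅ is a radical ideal; equivalently, the quotient ring ℚ[x₀, …, x₅]/(x₀x₁ − x₂x₃, x₀x₁ − x₄x₅) is a reduced ring. -/
open MvPolynomial

/-- Monomials in elements with `z₀z₁ = z₂z₃ = z₄z₅` can be rewritten so that neither `z₂z₃` nor
`z₄z₅` divides them. -/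
lemma monomial_eq_normalForm {R : Type*} [CommRing R] (z : Fin 6 → R)
    (h₁ : z 0 * z 1 = z 2 * z 3) (h₂ : z 0 * z 1 = z 4 * z 5) (e : Fin 6 → ℕ) :
    ∏ i, z i ^ e i =
      z 0 ^ (e 0 + min (e 2) (e 3) + min (e 4) (e 5)) *
      z 1 ^ (e 1 + min (e 2) (e 3) + min (e 4) (e 5)) *
      z 2 ^ (e 2 - e 3) * z 3 ^ (e 3 - e 2) * z 4 ^ (e 4 - e 5) * z 5 ^ (e 5 - e 4) := by
  have split (x y : R) (a b : ℕ) :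
      x ^ a * y ^ b = (x * y) ^ min a b * x ^ (a - b) * y ^ (b - a) := by
    obtain ⟨c, rfl⟩ | ⟨c, rfl⟩ := (le_total a b).imp Nat.exists_eq_add_of_le
      Nat.exists_eq_add_of_le
    · simp [pow_add, mul_pow, mul_assoc]
    · simp [pow_add, mul_pow]
      ring
  calc ∏ i, z i ^ e i
      = z 0 ^ e 0 * z 1 ^ e 1 * (z 2 ^ e 2 * z 3 ^ e 3) * (z 4 ^ e 4 * z 5 ^ e 5) := by
        rw [Fin.prod_univ_six]; ring
    _ = _ := by
        rw [split (z 2), split (z 4), ← h₁, ← h₂]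
        ring

/-- The action on exponents of the monomial map
`(x₀, …, x₅) ↦ (a, bcs, b, acs, c, abs)`. -/
noncomputable def toricExponent (e : Fin 6 →₀ ℕ) : Fin 4 →₀ ℕ :=
  Finsupp.equivFunOnFinite.symm
    ![e 0 + e 3 + e 5, e 1 + e 2 + e 5, e 1 + e 3 + e 4, e 1 + e 3 + e 5]

/-- The monomial map `(x₀, …, x₅) ↦ (a, bcs, b, acs, c, abs)`. -/
noncomputable def toricMap : MvPolynomial (Fin 6) ℚ →ₐ[ℚ] MvPolynomial (Fin 4) ℚ :=
  aeval ![X 0, X 1 * X 2 * X 3, X 1, X 0 * X 2 * X 3, X 2, X 0 * X 1 * X 3]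

lemma toricMap_monomial (e : Fin 6 →₀ ℕ) :
    toricMap (monomial e 1) = monomial (toricExponent e) 1 := by
  rw [toricMap, aeval_monomial, monomial_eq (s := toricExponent e),
    Finsupp.prod_fintype _ _ (by simp), Finsupp.prod_fintype _ _ (by simp),
    Fin.prod_univ_six, Fin.prod_univ_four]
  simp [toricExponent]
  ring

lemma prod_pow_eq_of_toricExponent_eq {R : Type*} [CommRing R] (z : Fin 6 → R)
    (h₁ : z 0 * z 1 = z 2 * z 3) (h₂ : z 0 * z 1 = z 4 * z 5) {e f : Fin 6 →₀ ℕ}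
    (h : toricExponent e = toricExponent f) :
    ∏ i, z i ^ e i = ∏ i, z i ^ f i := by
  have ha := DFunLike.congr_fun h 0
  have hb := DFunLike.congr_fun h 1
  have hc := DFunLike.congr_fun h 2
  have hs := DFunLike.congr_fun h 3
  simp only [toricExponent, Finsupp.equivFunOnFinite_symm_apply_apply, Matrix.cons_val]
    at ha hb hc hs
  rw [monomial_eq_normalForm z h₁ h₂, monomial_eq_normalForm z h₁ h₂]
  have h0 : e 0 + min (e 2) (e 3) + min (e 4) (e 5) =
      f 0 + min (f 2) (f 3) + min (f 4) (f 5) := by omega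
  have h1 : e 1 + min (e 2) (e 3) + min (e 4) (e 5) =
      f 1 + min (f 2) (f 3) + min (f 4) (f 5) := by omega
  have h2 : e 2 - e 3 = f 2 - f 3 := by omega
  have h3 : e 3 - e 2 = f 3 - f 2 := by omega
  have h4 : e 4 - e 5 = f 4 - f 5 := by omega
  have h5 : e 5 - e 4 = f 5 - f 4 := by omega
  rw [h0, h1, h2, h3, h4, h5]

lemma ker_toricMap :
    RingHom.ker toricMap = Ideal.span {(X 0 * X 1 - X 2 * X 3 : MvPolynomial (Fin 6) ℚ),
      (X 0 * X 1 - X 4 * X 5 : MvPolynomial (Fin 6) ℚ)} := by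
  set I := Ideal.span {(X 0 * X 1 - X 2 * X 3 : MvPolynomial (Fin 6) ℚ),
    (X 0 * X 1 - X 4 * X 5 : MvPolynomial (Fin 6) ℚ)} with hI
  apply le_antisymm
  · let mk := Ideal.Quotient.mkₐ ℚ I
    have h₁ : mk (X 0) * mk (X 1) = mk (X 2) * mk (X 3) := by
      rw [← map_mul, ← map_mul]
      exact Ideal.Quotient.eq.2 (Ideal.subset_span (by simp))
    have h₂ : mk (X 0) * mk (X 1) = mk (X 4) * mk (X 5) := by
      rw [← map_mul, ← map_mul]
      exact Ideal.Quotient.eq.2 (Ideal.subset_span (by simp))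
    have mk_monomial (e : Fin 6 →₀ ℕ) : mk (monomial e 1) = ∏ i, mk (X i) ^ e i := by
      rw [monomial_eq, Finsupp.prod_fintype _ _ (by simp)]
      simp
    let L : MvPolynomial (Fin 4) ℚ →ₗ[ℚ] MvPolynomial (Fin 6) ℚ ⧸ I :=
      (basisMonomials (Fin 4) ℚ).constr ℚ
        fun n ↦ mk (monomial (Function.invFun toricExponent n) 1)
    have hL : L ∘ₗ toricMap.toLinearMap = mk.toLinearMap := by
      refine (basisMonomials (Fin 6) ℚ).ext fun e ↦ ?_
      have hLe : L (monomial (toricExponent e) 1) =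
          mk (monomial (Function.invFun toricExponent (toricExponent e)) 1) := by
        simpa only [coe_basisMonomials] using
          (basisMonomials (Fin 4) ℚ).constr_basis ℚ _ (toricExponent e)
      simp only [coe_basisMonomials, LinearMap.comp_apply, AlgHom.toLinearMap_apply,
        toricMap_monomial, hLe, mk_monomial]
      exact prod_pow_eq_of_toricExponent_eq (fun i ↦ mk (X i)) h₁ h₂
        (Function.invFun_eq ⟨e, rfl⟩)
    intro p hp
    have hp' : mk p = 0 := by
      rw [← AlgHom.toLinearMap_apply, ← hL, LinearMap.comp_apply, AlgHom.toLinearMap_apply,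
        (RingHom.mem_ker).1 hp, map_zero]
    exact Ideal.Quotient.eq_zero_iff_mem.1 hp'
  · rw [hI, Ideal.span_le]
    rintro p (rfl | rfl) <;>
    · simp only [SetLike.mem_coe, RingHom.mem_ker, toricMap, map_sub, map_mul, aeval_X,
        Matrix.cons_val]
      ring

/-- The ideal `(x₀x₁ - x₂x₃, x₀x₁ - x₄x₅)` of `ℚ[x₀, …, x₅]` is radical;
equivalently, the quotient ring is reduced. -/
theorem ideal_is_radical :
    (Ideal.span {(X 0 * X 1 - X 2 * X 3 : MvPolynomial (Fin 6) ℚ),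
        (X 0 * X 1 - X 4 * X 5 : MvPolynomial (Fin 6) ℚ)}).IsRadical ∧
    IsReduced (MvPolynomial (Fin 6) ℚ ⧸
      Ideal.span {(X 0 * X 1 - X 2 * X 3 : MvPolynomial (Fin 6) ℚ),
        (X 0 * X 1 - X 4 * X 5 : MvPolynomial (Fin 6) ℚ)}) := by
  rw [← Ideal.isRadical_iff_quotient_reduced, and_self, ← ker_toricMap]
  exact (RingHom.ker_isPrime toricMap).isRadical
end
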